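/- Let d ≥ 2, let P be a Borel probability measure on ℝ^d whose absolute moments m_N := ∫ ‖x‖^N dP(x) are finite for all N ≥ 1 and satisfy ∑_{N≥1} m_N^{-1/N} = ∞, and let T : ℝ^d → ℝ^d be an invertible linear map. If the pushforward PT⁻¹ of P under T is not equal to P, then the set E(P, PT⁻¹) has Lebesgue measure zero in ℝ^d; in particular, for Lebesgue-almost every h ∈ ℝ^d there exists t ∈ ℝ with φ_P(th) ≠ φ_{PT⁻¹}(th). -/

import Mathlib

open MeasureTheory
open scoped RealInnerProductSpace

/-- The characteristic function `φ_P(y) := ∫ exp(i⟨y,z⟩) dP(z)` of a Borel probability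
measure `P` on `ℝ^d`. -/
noncomputable def charFn {d : ℕ} (P : Measure (EuclideanSpace ℝ (Fin d)))
    (y : EuclideanSpace ℝ (Fin d)) : ℂ :=
  ∫ z, Complex.exp ((⟪y, z⟫ : ℝ) * Complex.I) ∂P


lemma bang_growth {g : ℕ → ℝ → ℂ} (hg : ∀ n t, HasDerivAt (g n) (g (n+1) t) t)
    {A : ℕ → ℝ} {r : ℝ} {N : ℕ} (hA : ∀ n, 0 ≤ A n) (hr : 0 ≤ r)
    (hAr : ∀ j, j < N → A (j+1) ≤ r * A j)
    (hN : ∀ t, ‖g N t‖ ≤ A N) {y : ℝ} (hy : ∀ j, j ≤ N → ‖g j y‖ ≤ A j) :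
    ∀ k, k ≤ N → ∀ h, 0 ≤ h → ‖g (N - k) (y + h)‖ ≤ A (N - k) * Real.exp (r * h) := by
  intro k
  induction k with
  | zero =>
    intro _ h hh
    refine (hN _).trans (le_mul_of_one_le_right (hA _) (Real.one_le_exp (by positivity)))
  | succ k ih =>
    intro hk h hh
    obtain ⟨j, hj⟩ : ∃ j, N - (k+1) = j := ⟨_, rfl⟩
    have hj1 : N - k = j + 1 := by omega
    have ih' := ih (by omega)
    rw [hj1] at ih'
    rw [hj]
    have key := image_norm_le_of_norm_deriv_right_le_deriv_boundary (a := 0) (b := h)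
      (f := fun s => g j (y + s)) (f' := fun s => g (j+1) (y + s))
      (B := fun s => A j * Real.exp (r * s)) (B' := fun s => A j * (Real.exp (r * s) * r))
      ?_ ?_ ?_ ?_ ?_ (x := h) ⟨hh, le_rfl⟩
    · exact key
    · intro s _
      exact ((hg j (y+s)).comp_const_add y s).continuousAt.continuousWithinAt
    · intro s _
      exact ((hg j (y+s)).comp_const_add y s).hasDerivWithinAt
    · simpa using hy j (by omega)
    · intro s
      have : HasDerivAt (fun s => r * s) r s := by simpa using (hasDerivAt_id s).const_mul r
      exact this.exp.const_mul _
    · intro s hs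
      refine (ih' s hs.1).trans ?_
      have := mul_le_mul_of_nonneg_right (hAr j (by omega)) (Real.exp_pos (r*s)).le
      linarith

/-- One step of Bang's argument. -/
lemma bang_step {g : ℕ → ℝ → ℂ} (hg : ∀ n t, HasDerivAt (g n) (g (n+1) t) t)
    {M : ℕ → ℝ} (hM : ∀ n, 0 < M n) (hlc : ∀ n, M (n+1) * M (n+1) ≤ M n * M (n+2))
    (hb : ∀ n t, ‖g n t‖ ≤ M n) {N : ℕ} {y : ℝ}
    (hy : ∀ n : ℕ, ‖g n y‖ ≤ Real.exp (n - (N+1)) * M n) {h : ℝ} (hh : 0 ≤ h)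
    (hh' : h ≤ M N / (Real.exp 1 * M (N+1))) :
    ∀ n : ℕ, ‖g n (y+h)‖ ≤ Real.exp (n - N) * M n := by
  intro n
  rcases le_or_gt n (N+1) with hn | hn
  · have hmono : Monotone (fun n => M (n+1) / M n) := by
      refine monotone_nat_of_le_succ fun n => ?_
      rw [div_le_div_iff₀ (hM _) (hM _)]
      linarith [hlc n]
    have h1 := bang_growth hg (A := fun n : ℕ => Real.exp (n - (N+1)) * M n)
      (r := Real.exp 1 * (M (N+1) / M N)) (N := N+1) (y := y)
      (fun n => by have := hM n; positivity) (by have := hM N; have := hM (N+1); positivity)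
      (fun j hj => by
        have h2 := hmono (show j ≤ N by omega)
        simp only at h2
        have h3 : M (j+1) ≤ M (N+1) / M N * M j := by rwa [div_le_iff₀ (hM j)] at h2
        have h4 : Real.exp (((j+1 : ℕ) : ℝ) - (N+1)) = Real.exp 1 * Real.exp (j - (N+1)) := by
          rw [← Real.exp_add]; congr 1; push_cast; ring
        simp only [h4]
        calc _ ≤ Real.exp 1 * Real.exp (j - (N+1)) * (M (N+1) / M N * M j) := by gcongr
          _ = _ := by ring)
      (fun t => by simpa using hb (N+1) t) (fun j _ => hy j) (N + 1 - n) (by omega) h hh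
    have h5 : N + 1 - (N + 1 - n) = n := by omega
    rw [h5] at h1
    refine h1.trans ?_
    have h6 : Real.exp 1 * (M (N+1) / M N) * h ≤ 1 := by
      have := hM N
      have := hM (N+1)
      rw [le_div_iff₀ (by positivity)] at hh'
      rw [show Real.exp 1 * (M (N+1) / M N) * h = (h * (Real.exp 1 * M (N+1))) / M N by ring]
      rwa [div_le_one (by positivity)]
    have := hM n
    calc _ ≤ Real.exp (n - (N+1)) * M n * Real.exp 1 := by gcongr
      _ = (Real.exp (n - (N+1)) * Real.exp 1) * M n := by ring
      _ = _ := by rw [← Real.exp_add]; congr 2; ring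
  · refine (hb n _).trans (le_mul_of_one_le_left (hM _).le (Real.one_le_exp ?_))
    have : (N : ℝ) ≤ n := by exact_mod_cast (by omega : N ≤ n)
    linarith

lemma bang_iter {g : ℕ → ℝ → ℂ} (hg : ∀ n t, HasDerivAt (g n) (g (n+1) t) t)
    {M : ℕ → ℝ} (hM : ∀ n, 0 < M n) (hlc : ∀ n, M (n+1) * M (n+1) ≤ M n * M (n+2))
    (hb : ∀ n t, ‖g n t‖ ≤ M n) (K : ℕ) : ∀ (l : ℕ) (y : ℝ),
    (∀ n : ℕ, ‖g n y‖ ≤ Real.exp (n - (K + l : ℕ)) * M n) → ∀ h, 0 ≤ h →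
    h ≤ ∑ i ∈ Finset.range l, M (K+i) / (Real.exp 1 * M (K+i+1)) →
    ∀ n : ℕ, ‖g n (y+h)‖ ≤ Real.exp (n - K) * M n := by
  intro l
  induction l with
  | zero =>
    intro y hy h hh hh' n
    have : h = 0 := by simp at hh'; linarith
    subst this
    simpa using hy n
  | succ l ih =>
    intro y hy h hh hh' n
    rw [Finset.sum_range_succ] at hh'
    set s := M (K+l) / (Real.exp 1 * M (K+l+1)) with hs
    have hs0 : 0 ≤ s := by have := hM (K+l); have := hM (K+l+1); positivity
    have h1 := bang_step hg hM hlc hb (N := K+l) (y := y) (h := min h s)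
      (fun n => by simpa [add_assoc] using hy n) (le_min hh hs0) (min_le_right _ _)
    have h2 := ih (y + min h s) h1 (h - min h s) (by simp) (by
      rcases le_total h s with h3 | h3
      · rw [min_eq_left h3]
        simp only [sub_self]
        exact Finset.sum_nonneg fun i _ => by
          have := hM (K+i); have := hM (K+i+1); positivity
      · rw [min_eq_right h3]; linarith) n
    simpa using h2

/-- Denjoy-Carleman (Bang). -/
lemma bang {g : ℕ → ℝ → ℂ} (hg : ∀ n t, HasDerivAt (g n) (g (n+1) t) t)
    {M : ℕ → ℝ} (hM : ∀ n, 0 < M n) (hlc : ∀ n, M (n+1) * M (n+1) ≤ M n * M (n+2))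
    (hb : ∀ n t, ‖g n t‖ ≤ M n) (h0 : ∀ n, g n 0 = 0)
    (hdiv : ¬ Summable (fun n => M n / M (n+1))) {t : ℝ} (ht : 0 ≤ t) : g 0 t = 0 := by
  have key : ∀ K : ℕ, ‖g 0 t‖ ≤ Real.exp (-K) * M 0 := by
    intro K
    have h1 : ¬ Summable (fun i => M (K+i) / (Real.exp 1 * M (K+i+1))) := by
      intro h
      apply hdiv
      rw [← summable_nat_add_iff K]
      refine (h.mul_left (Real.exp 1)).congr fun i => ?_
      have := (hM (K+i+1)).ne'
      rw [add_comm i K]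
      field_simp
    rw [not_summable_iff_tendsto_nat_atTop_of_nonneg (fun i => by
      have := hM (K+i); have := hM (K+i+1); positivity)] at h1
    obtain ⟨l, hl⟩ := (h1.eventually_ge_atTop t).exists
    have := bang_iter hg hM hlc hb K l 0
      (fun n => by rw [h0]; simp; have := hM n; positivity) t ht hl 0
    simpa using this
  have hl : Filter.Tendsto (fun K : ℕ => Real.exp (-(K:ℝ)) * M 0) Filter.atTop (nhds (0 * M 0)) :=
    ((Real.tendsto_exp_neg_atTop_nhds_zero).comp tendsto_natCast_atTop_atTop).mul_const _
  rw [zero_mul] at hl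
  have := ge_of_tendsto' hl key
  simpa using this

/-- Carleman's inequality, in the form of divergence. `b k` stands for `b_{k+1}`. -/
lemma carleman_ineq {b : ℕ → ℝ} (hb : ∀ n, 0 ≤ b n) (hs : Summable b) :
    Summable (fun n : ℕ => (∏ k ∈ Finset.range (n+1), b k) ^ (1 / ((n:ℝ)+1))) := by
  set c : ℕ → ℝ := fun k => ((k:ℝ)+2)^(k+1) / ((k:ℝ)+1)^k with hc
  have hcpos : ∀ k, 0 < c k := fun k => by positivity
  have hprod : ∀ n : ℕ, ∏ k ∈ Finset.range n, c k = ((n:ℝ)+1)^n := by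
    intro n
    induction n with
    | zero => simp
    | succ n ih =>
      rw [Finset.prod_range_succ, ih, hc]
      push_cast
      field_simp
      ring
  set S : ℕ → ℝ := fun n => ∑ k ∈ Finset.range n, c k * b k with hS
  have hS0 : ∀ n, 0 ≤ S n := fun n => Finset.sum_nonneg fun k _ => mul_nonneg (hcpos k).le (hb k)
  have hGM : ∀ n : ℕ, (∏ k ∈ Finset.range (n+1), b k) ^ (1 / ((n:ℝ)+1)) ≤
      S (n+1) / (((n:ℝ)+1) * ((n:ℝ)+2)) := by
    intro n
    have h1 := Real.geom_mean_le_arith_mean (Finset.range (n+1)) (fun _ => 1)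
      (fun k => c k * b k) (by simp) (by simp; positivity)
      (fun k _ => mul_nonneg (hcpos k).le (hb k))
    simp only [Real.rpow_one, Finset.sum_const, Finset.card_range, nsmul_eq_mul, mul_one,
      one_mul, Finset.prod_mul_distrib, hprod] at h1
    rw [Real.mul_rpow (by positivity) (Finset.prod_nonneg fun k _ => hb k),
      Real.pow_rpow_inv_natCast (by positivity) (by omega)] at h1
    push_cast at h1
    rw [one_div, le_div_iff₀ (by positivity)]
    rw [le_div_iff₀ (by positivity)] at h1
    calc _ = _ := by ring
      _ ≤ _ := h1
  have habel : ∀ n : ℕ, ∑ i ∈ Finset.range n, S (i+1) / (((i:ℝ)+1) * ((i:ℝ)+2))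
      + S n / ((n:ℝ)+1) = ∑ i ∈ Finset.range n, c i * b i / ((i:ℝ)+1) := by
    intro n
    induction n with
    | zero => simp [hS]
    | succ n ih =>
      rw [Finset.sum_range_succ, Finset.sum_range_succ, ← ih]
      have : S (n+1) = S n + c n * b n := by simp [hS, Finset.sum_range_succ]
      rw [this]
      push_cast
      field_simp
      ring
  have hce : ∀ i : ℕ, c i * b i / ((i:ℝ)+1) ≤ Real.exp 1 * b i := by
    intro i
    have h1 : c i / ((i:ℝ)+1) ≤ Real.exp 1 := by
      have h2 : c i / ((i:ℝ)+1) = (1/((i:ℝ)+1) + 1)^(i+1) := by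
        rw [hc]; simp only
        rw [div_add_one (by positivity), div_pow, div_div, ← pow_succ]; congr 2; ring
      rw [h2]
      calc _ ≤ (Real.exp (1/((i:ℝ)+1)))^(i+1) := by
            gcongr; exact Real.add_one_le_exp _
        _ = _ := by rw [← Real.exp_nat_mul]; congr 1; push_cast; field_simp
    calc _ = c i / ((i:ℝ)+1) * b i := by ring
      _ ≤ _ := mul_le_mul_of_nonneg_right h1 (hb i)
  refine summable_of_sum_range_le (c := Real.exp 1 * ∑' i, b i)
    (fun n => Real.rpow_nonneg (Finset.prod_nonneg fun k _ => hb k) _) fun n => ?_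
  calc _ ≤ ∑ i ∈ Finset.range n, S (i+1) / (((i:ℝ)+1) * ((i:ℝ)+2)) :=
        Finset.sum_le_sum fun i _ => hGM i
    _ ≤ ∑ i ∈ Finset.range n, c i * b i / ((i:ℝ)+1) := by
        rw [← habel]; have := hS0 n; linarith [show 0 ≤ S n / ((n:ℝ)+1) by positivity]
    _ ≤ ∑ i ∈ Finset.range n, Real.exp 1 * b i := Finset.sum_le_sum fun i _ => hce i
    _ = Real.exp 1 * ∑ i ∈ Finset.range n, b i := by rw [Finset.mul_sum]
    _ ≤ _ := by gcongr; exact hs.sum_le_tsum _ (fun i _ => hb i)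

lemma carleman_ratio {m : ℕ → ℝ} (hm : ∀ n, 0 < m n) (h0 : m 0 = 1)
    (h : ¬ Summable (fun N : ℕ => (m (N+1)) ^ (-1 / ((N : ℝ) + 1)))) :
    ¬ Summable (fun n => m n / m (n+1)) := by
  intro hs
  apply h
  have := carleman_ineq (fun n => (div_pos (hm n) (hm (n+1))).le) hs
  convert this using 2 with n
  have hp : ∀ n, ∏ k ∈ Finset.range n, m k / m (k+1) = (m n)⁻¹ := by
    intro n
    induction n with
    | zero => simp [h0]
    | succ n ih =>
      rw [Finset.prod_range_succ, ih]
      have := (hm n).ne'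
      field_simp
  rw [hp, Real.inv_rpow (hm _).le, ← Real.rpow_neg (hm _).le, neg_div]

lemma null_of_poly_lines {d : ℕ} {F : EuclideanSpace ℝ (Fin d) → ℝ} (hF : Measurable F)
    {x0 : EuclideanSpace ℝ (Fin d)} (hx0 : F x0 ≠ 0)
    (hp : ∀ y, ∃ p : Polynomial ℝ, ∀ t : ℝ, F (x0 + t • y) = p.eval t) :
    volume {x | F x = 0} = 0 := by
  have h1 : ∀ y : EuclideanSpace ℝ (Fin d), ∀ᵐ t : ℝ, F (x0 + t • y) ≠ 0 := by
    intro y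
    obtain ⟨p, hp⟩ := hp y
    have hp0 : p ≠ 0 := by
      rintro rfl
      have := hp 0
      simp at this
      exact hx0 this
    rw [ae_iff]
    refine Set.Finite.measure_zero ?_ _
    refine (p.roots.toFinset.finite_toSet).subset fun t ht => ?_
    simp only [ne_eq, not_not, Set.mem_setOf_eq, hp] at ht
    simp [hp0, ht]
  have hm : MeasurableSet {q : EuclideanSpace ℝ (Fin d) × ℝ | F (x0 + q.2 • q.1) ≠ 0} := by
    have h2 : Measurable fun q : EuclideanSpace ℝ (Fin d) × ℝ => F (x0 + q.2 • q.1) :=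
      hF.comp (by fun_prop)
    exact (measurableSet_eq_fun h2 measurable_const).compl
  have h3 := (Measure.ae_ae_comm (μ := (volume : Measure (EuclideanSpace ℝ (Fin d))))
    (ν := (volume : Measure ℝ)) (p := fun y t => F (x0 + t • y) ≠ 0) hm).1
      (Filter.Eventually.of_forall h1)
  have h4 : ∀ᵐ t : ℝ, t ≠ 0 := by simp [ae_iff]
  obtain ⟨t, ht, ht0⟩ := (h3.and h4).exists
  rw [ae_iff] at ht
  have h5 := Measure.addHaar_preimage_smul (volume : Measure (EuclideanSpace ℝ (Fin d))) ht0
    ((fun x => x0 + x) ⁻¹' {x | F x = 0})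
  rw [measure_preimage_add] at h5
  have h6 : ((t • ·) ⁻¹' ((fun x => x0 + x) ⁻¹' {x | F x = 0})) = 
    {a : EuclideanSpace ℝ (Fin d) | ¬ F (x0 + t • a) ≠ 0} := by ext; simp
  rw [h6, ht] at h5
  rcases mul_eq_zero.1 h5.symm with h7 | h7
  · exfalso
    rw [ENNReal.ofReal_eq_zero] at h7
    have : 0 < |(t ^ Module.finrank ℝ (EuclideanSpace ℝ (Fin d)))⁻¹| := by positivity
    linarith
  · exact h7

section
variable {d : ℕ} {P : Measure (EuclideanSpace ℝ (Fin d))} [IsProbabilityMeasure P]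

lemma mom_all (hmom : ∀ N : ℕ, 1 ≤ N → Integrable (fun x => ‖x‖ ^ N) P) (N : ℕ) :
    Integrable (fun x => ‖x‖ ^ N) P := by
  rcases Nat.eq_zero_or_pos N with rfl | h
  · simp
  · exact hmom N h

lemma mom_logconvex (hmom : ∀ N : ℕ, Integrable (fun x => ‖x‖ ^ N) P)
    (hpos : ∀ n, 0 < ∫ x, ‖x‖ ^ n ∂P) (n : ℕ) :
    (∫ x, ‖x‖ ^ (n+1) ∂P) * (∫ x, ‖x‖ ^ (n+1) ∂P) ≤
      (∫ x, ‖x‖ ^ n ∂P) * (∫ x, ‖x‖ ^ (n+2) ∂P) := by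
  set a := ∫ x, ‖x‖ ^ n ∂P with ha
  set b := ∫ x, ‖x‖ ^ (n+1) ∂P with hb
  set c := ∫ x, ‖x‖ ^ (n+2) ∂P with hc
  have h : 0 ≤ ∫ x, ‖x‖ ^ n * (b - a * ‖x‖) ^ 2 ∂P := 
    integral_nonneg fun x => by positivity
  have h2 : ∫ x, ‖x‖ ^ n * (b - a * ‖x‖) ^ 2 ∂P = b^2 * a - 2 * a * b * b + a^2 * c := by
    have : (fun x : EuclideanSpace ℝ (Fin d) => ‖x‖ ^ n * (b - a * ‖x‖) ^ 2) =
      fun x => b^2 * ‖x‖^n - 2 * a * b * ‖x‖^(n+1) + a^2 * ‖x‖^(n+2) := by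
      ext x; ring
    rw [this, integral_add, integral_sub, integral_const_mul, integral_const_mul,
      integral_const_mul]
    · exact (hmom _).const_mul _
    · exact (hmom _).const_mul _
    · exact ((hmom _).const_mul _).sub ((hmom _).const_mul _)
    · exact (hmom _).const_mul _
  have h3 := hpos n
  rw [h2] at h
  by_contra hcon
  push Not at hcon
  have := mul_pos h3 (sub_pos.2 hcon)
  nlinarith

lemma mom_pos (hmom : ∀ N : ℕ, Integrable (fun x => ‖x‖ ^ N) P)
    (hcarleman : ¬ Summable (fun N : ℕ =>
      (∫ x, ‖x‖ ^ (N + 1) ∂P) ^ (-1 / ((N : ℝ) + 1)))) (n : ℕ) : 0 < ∫ x, ‖x‖ ^ n ∂P := by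
  refine lt_of_le_of_ne (integral_nonneg fun x => by positivity) fun h => ?_
  rw [eq_comm, integral_eq_zero_iff_of_nonneg (fun x => by positivity) (hmom n)] at h
  apply hcarleman
  have : ∀ N : ℕ, ∫ x, ‖x‖ ^ (N + 1) ∂P = 0 := by
    intro N
    rw [integral_eq_zero_iff_of_nonneg (fun x => by positivity) (hmom _)]
    filter_upwards [h] with x hx
    have : ‖x‖ = 0 := by
      by_contra h0
      exact pow_ne_zero n h0 hx
    simp [this]
  simp only [this]
  convert summable_zero with N
  exact Real.zero_rpow (by have : (N:ℝ) + 1 ≠ 0 := by positivity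
                           simp [neg_div, this])

noncomputable def gfn (P : Measure (EuclideanSpace ℝ (Fin d))) (u : EuclideanSpace ℝ (Fin d) → ℝ)
    (n : ℕ) (t : ℝ) : ℂ :=
  ∫ z, ((u z : ℂ) * Complex.I) ^ n * Complex.exp ((t * u z : ℝ) * Complex.I) ∂P

lemma gfn_norm_le (u : EuclideanSpace ℝ (Fin d) → ℝ) {C : ℝ}
    (huC : ∀ z, |u z| ≤ C * ‖z‖) (n : ℕ) (t : ℝ) (z : EuclideanSpace ℝ (Fin d)) :
    ‖((u z : ℂ) * Complex.I) ^ n * Complex.exp ((t * u z : ℝ) * Complex.I)‖ ≤ C^n * ‖z‖^n := by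
  rw [norm_mul, Complex.norm_exp_ofReal_mul_I, mul_one, norm_pow, norm_mul, Complex.norm_I, mul_one,
    Complex.norm_real, Real.norm_eq_abs, ← mul_pow]
  gcongr
  exact huC z

lemma gfn_int (hmom : ∀ N : ℕ, Integrable (fun x => ‖x‖ ^ N) P)
    {u : EuclideanSpace ℝ (Fin d) → ℝ} (hu : Continuous u) {C : ℝ}
    (huC : ∀ z, |u z| ≤ C * ‖z‖) (n : ℕ) (t : ℝ) :
    Integrable (fun z => ((u z : ℂ) * Complex.I) ^ n * Complex.exp ((t * u z : ℝ) * Complex.I)) P :=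
  ((hmom n).const_mul (C^n)).mono' (by fun_prop)
    (Filter.Eventually.of_forall fun z => gfn_norm_le u huC n t z)

lemma gfn_bound (hmom : ∀ N : ℕ, Integrable (fun x => ‖x‖ ^ N) P)
    {u : EuclideanSpace ℝ (Fin d) → ℝ} {C : ℝ}
    (huC : ∀ z, |u z| ≤ C * ‖z‖) (n : ℕ) (t : ℝ) :
    ‖gfn P u n t‖ ≤ C^n * ∫ x, ‖x‖ ^ n ∂P := by
  rw [← integral_const_mul]
  exact norm_integral_le_of_norm_le ((hmom n).const_mul (C^n))
    (Filter.Eventually.of_forall fun z => gfn_norm_le u huC n t z)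

lemma gfn_deriv (hmom : ∀ N : ℕ, Integrable (fun x => ‖x‖ ^ N) P)
    {u : EuclideanSpace ℝ (Fin d) → ℝ} (hu : Continuous u) {C : ℝ}
    (huC : ∀ z, |u z| ≤ C * ‖z‖) (n : ℕ) (t : ℝ) :
    HasDerivAt (gfn P u n) (gfn P u (n+1) t) t := by
  refine (hasDerivAt_integral_of_dominated_loc_of_deriv_le (s := Set.univ)
    (F := fun t z => ((u z : ℂ) * Complex.I) ^ n * Complex.exp ((t * u z : ℝ) * Complex.I))
    (F' := fun t z => ((u z : ℂ) * Complex.I) ^ (n+1) * Complex.exp ((t * u z : ℝ) * Complex.I))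
    (bound := fun z => C^(n+1) * ‖z‖^(n+1))
    Filter.univ_mem (Filter.Eventually.of_forall fun t => (gfn_int hmom hu huC n t).1)
    (gfn_int hmom hu huC n t) (gfn_int hmom hu huC (n+1) t).1
    (Filter.Eventually.of_forall fun z t _ => gfn_norm_le u huC (n+1) t z)
    ((hmom _).const_mul _) (Filter.Eventually.of_forall fun z t _ => ?_)).2
  have h1 : HasDerivAt (fun t : ℝ => ((t * u z : ℝ) : ℂ) * Complex.I) (u z * Complex.I) t := by
    have : HasDerivAt (fun t : ℝ => t * u z) (u z) t := by
      simpa using (hasDerivAt_id t).mul_const (u z)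
    exact this.ofReal_comp.mul_const _
  refine ((h1.cexp).const_mul (((u z : ℂ) * Complex.I) ^ n)).congr_deriv ?_
  rw [pow_succ]
  ring

lemma gfn_zero (u : EuclideanSpace ℝ (Fin d) → ℝ) (n : ℕ) :
    gfn P u n 0 = ((∫ z, u z ^ n ∂P : ℝ) : ℂ) * Complex.I ^ n := by
  unfold gfn
  rw [← integral_complex_ofReal, ← integral_mul_const]
  congr 1; ext z
  simp [mul_pow]

lemma poly_line (hmom : ∀ N : ℕ, Integrable (fun x => ‖x‖ ^ N) P)
    {u v : EuclideanSpace ℝ (Fin d) → ℝ} (hu : Continuous u) (hv : Continuous v) {C D : ℝ}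
    (huC : ∀ z, |u z| ≤ C * ‖z‖) (hvD : ∀ z, |v z| ≤ D * ‖z‖) (n : ℕ) :
    ∃ p : Polynomial ℝ, ∀ t : ℝ, ∫ z, (u z + t * v z) ^ n ∂P = p.eval t := by
  refine ⟨∑ k ∈ Finset.range (n+1), 
    Polynomial.monomial (n-k) ((∫ z, u z ^ k * v z ^ (n-k) ∂P) * n.choose k), fun t => ?_⟩
  simp only [add_pow, Polynomial.eval_finsetSum, Polynomial.eval_monomial]
  have hi : ∀ k ∈ Finset.range (n+1), Integrable (fun z => u z ^ k * v z ^ (n-k)) P := by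
    intro k hk
    refine ((hmom n).const_mul (C^k * D^(n-k))).mono' (by fun_prop)
      (Filter.Eventually.of_forall fun z => ?_)
    have hk' : k + (n - k) = n := by simp at hk; omega
    rw [norm_mul, norm_pow, norm_pow, Real.norm_eq_abs, Real.norm_eq_abs]
    calc |u z|^k * |v z|^(n-k) ≤ (C * ‖z‖)^k * (D*‖z‖)^(n-k) := by
          have := huC z
          have := hvD z
          have := (abs_nonneg _).trans (huC z)
          gcongr
      _ = C^k * D^(n-k) * ‖z‖^(k + (n-k)) := by ring
      _ = _ := by rw [hk']
  have he : ∀ k z, u z ^ k * (t * v z) ^ (n - k) * (n.choose k : ℝ) =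
      (u z ^ k * v z ^ (n-k)) * (n.choose k * t^(n-k)) := fun k z => by ring
  simp only [he]
  rw [integral_finset_sum _ (fun k hk => (hi k hk).mul_const _)]
  refine Finset.sum_congr rfl fun k _ => ?_
  rw [integral_mul_const]
  ring

lemma charFn_map (L : EuclideanSpace ℝ (Fin d) →L[ℝ] EuclideanSpace ℝ (Fin d))
    (x : EuclideanSpace ℝ (Fin d)) (t : ℝ) :
    charFn (P.map L) (t • x) = gfn P (fun z => ⟪x, L z⟫) 0 t := by
  unfold charFn gfn
  rw [integral_map (by fun_prop) (by fun_prop)]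
  simp [inner_smul_left]

lemma inner_bd (L : EuclideanSpace ℝ (Fin d) →L[ℝ] EuclideanSpace ℝ (Fin d))
    (x z : EuclideanSpace ℝ (Fin d)) : |⟪x, L z⟫| ≤ (‖x‖ * (1 + ‖L‖)) * ‖z‖ := by
  calc _ ≤ ‖x‖ * ‖L z‖ := abs_real_inner_le_norm _ _
    _ ≤ ‖x‖ * ((1 + ‖L‖) * ‖z‖) := by
      gcongr
      refine (L.le_opNorm z).trans ?_
      gcongr
      linarith
    _ = _ := by ring

lemma moments_meas (L : EuclideanSpace ℝ (Fin d) →L[ℝ] EuclideanSpace ℝ (Fin d)) (n : ℕ) :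
    Measurable fun x => ∫ z, ⟪x, L z⟫ ^ n ∂P := by
  have : StronglyMeasurable (Function.uncurry
    fun (x z : EuclideanSpace ℝ (Fin d)) => (⟪x, L z⟫ : ℝ) ^ n) := by
    apply Continuous.stronglyMeasurable
    simp only [Function.uncurry_def]
    fun_prop
  exact (this.integral_prod_right (ν := P)).measurable

end

lemma main_null {d : ℕ}
    (P : Measure (EuclideanSpace ℝ (Fin d))) [IsProbabilityMeasure P]
    (hmom' : ∀ N : ℕ, 1 ≤ N → Integrable (fun x => ‖x‖ ^ N) P)
    (hcarleman : ¬ Summable (fun N : ℕ =>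
      (∫ x, ‖x‖ ^ (N + 1) ∂P) ^ (-1 / ((N : ℝ) + 1))))
    (L : EuclideanSpace ℝ (Fin d) →L[ℝ] EuclideanSpace ℝ (Fin d))
    (hne : P.map ⇑L ≠ P) :
    volume {x : EuclideanSpace ℝ (Fin d) |
        ∀ t : ℝ, charFn P (t • x) = charFn (P.map ⇑L) (t • x)} = 0 := by
  have hmom := mom_all hmom'
  have hpos := mom_pos hmom hcarleman
  set I1 := ContinuousLinearMap.id ℝ (EuclideanSpace ℝ (Fin d)) with hI1
  have hid : ∀ (x : EuclideanSpace ℝ (Fin d)) (t : ℝ),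
      charFn P (t • x) = gfn P (fun z => ⟪x, I1 z⟫) 0 t := by
    intro x t
    rw [← charFn_map]
    simp [hI1]
  by_cases hall : ∀ n x, ∫ z, ⟪x, I1 z⟫ ^ n ∂P = ∫ z, ⟪x, L z⟫ ^ n ∂P
  · exfalso
    apply hne
    haveI : IsProbabilityMeasure (P.map ⇑L) :=
      Measure.isProbabilityMeasure_map (by fun_prop)
    have heq : ∀ x, charFn P x = charFn (P.map ⇑L) x := by
      intro x
      set A := ‖x‖ * (1 + ‖I1‖) + ‖x‖ * (1 + ‖L‖) + 1 with hA
      have hA0 : 0 < A := by positivity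
      have hu1 : ∀ z, |⟪x, I1 z⟫| ≤ A * ‖z‖ := fun z => (inner_bd I1 x z).trans (by
        gcongr; have : 0 ≤ ‖x‖ * (1 + ‖L‖) := by positivity
        linarith)
      have hu2 : ∀ z, |⟪x, L z⟫| ≤ A * ‖z‖ := fun z => (inner_bd L x z).trans (by
        gcongr; have : 0 ≤ ‖x‖ * (1 + ‖I1‖) := by positivity
        linarith)
      have key := bang
        (g := fun n t => gfn P (fun z => ⟪x, I1 z⟫) n t - gfn P (fun z => ⟪x, L z⟫) n t)
        (M := fun n => 2 * (A^n * ∫ z, ‖z‖^n ∂P))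
        (fun n t => (gfn_deriv hmom (by fun_prop) hu1 n t).sub
          (gfn_deriv hmom (by fun_prop) hu2 n t))
        (fun n => by have := hpos n; positivity)
        (fun n => by
          have := mul_le_mul_of_nonneg_left (mom_logconvex hmom hpos n)
            (show 0 ≤ 4 * A^(2*n+2) by positivity)
          calc _ = _ := by ring
            _ ≤ _ := this
            _ = _ := by ring)
        (fun n t => (norm_sub_le _ _).trans (by
          have h1 := gfn_bound hmom hu1 n t
          have h2 := gfn_bound hmom hu2 n t
          linarith))
        (fun n => by
          simp only [gfn_zero]
          rw [hall n x, sub_self])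
        (fun hs => by
          refine carleman_ratio hpos (by simp) hcarleman ?_
          refine (hs.mul_left A).congr fun n => ?_
          have := (hpos (n+1)).ne'
          field_simp
          ring)
        (t := 1) zero_le_one
      have h1 := hid x 1
      have h2 := charFn_map (P := P) L x 1
      rw [one_smul] at h1 h2
      rw [h1, h2]
      exact sub_eq_zero.1 key
    refine Measure.ext_of_charFun ?_
    ext x
    have := heq x
    simp only [charFn] at this
    rw [charFun_apply, charFun_apply]
    simp only [real_inner_comm x]
    exact this.symm
  · push Not at hall
    obtain ⟨n, x0, hx0⟩ := hall
    have hnull := null_of_poly_lines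
      (F := fun x => ∫ z, ⟪x, I1 z⟫ ^ n ∂P - ∫ z, ⟪x, L z⟫ ^ n ∂P)
      ((moments_meas I1 n).sub (moments_meas L n)) (x0 := x0) (sub_ne_zero.2 hx0) (by
        intro y
        obtain ⟨p, hp⟩ := poly_line hmom (by fun_prop) (by fun_prop)
          (inner_bd I1 x0) (inner_bd I1 y) n
        obtain ⟨q, hq⟩ := poly_line hmom (by fun_prop) (by fun_prop)
          (inner_bd L x0) (inner_bd L y) n
        refine ⟨p - q, fun t => ?_⟩
        rw [Polynomial.eval_sub, ← hp, ← hq]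
        simp only [inner_add_left, real_inner_smul_left])
    refine measure_mono_null (fun x hx => ?_) hnull
    simp only [Set.mem_setOf_eq] at hx ⊢
    have h0 : ∀ n, gfn P (fun z => ⟪x, I1 z⟫) n = gfn P (fun z => ⟪x, L z⟫) n := by
      intro n
      induction n with
      | zero =>
        ext t
        rw [← hid, ← charFn_map, hx]
      | succ n ih =>
        ext t
        have h1 := gfn_deriv hmom (by fun_prop) (inner_bd I1 x) n t
        have h2 := gfn_deriv hmom (by fun_prop) (inner_bd L x) n t
        rw [ih] at h1
        exact h1.unique h2
    have h1 := congrFun (h0 n) 0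
    rw [gfn_zero, gfn_zero] at h1
    have h2 := mul_right_cancel₀ (pow_ne_zero n Complex.I_ne_zero) h1
    rw [sub_eq_zero]
    exact_mod_cast h2

/-- Let `P` be a Borel probability measure on `ℝ^d` (`d ≥ 2`) whose absolute
moments `m_N = ∫ ‖x‖^N dP` are all finite and satisfy `∑_{N≥1} m_N^{-1/N} = ∞`, and let `T` be
an invertible linear map. If `P T⁻¹ ≠ P`, then `E(P, PT⁻¹)` has Lebesgue measure zero; in
particular, for Lebesgue-a.e. `h` there is `t ∈ ℝ` with `φ_P(th) ≠ φ_{PT⁻¹}(th)`. -/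
theorem eqCharFn_set_null_of_ne
    {d : ℕ} (hd : 2 ≤ d)
    (P : Measure (EuclideanSpace ℝ (Fin d))) [IsProbabilityMeasure P]
    (hmom : ∀ N : ℕ, 1 ≤ N → Integrable (fun x => ‖x‖ ^ N) P)
    (hcarleman : ¬ Summable (fun N : ℕ =>
      (∫ x, ‖x‖ ^ (N + 1) ∂P) ^ (-1 / ((N : ℝ) + 1))))
    (T : EuclideanSpace ℝ (Fin d) ≃ₗ[ℝ] EuclideanSpace ℝ (Fin d))
    (hne : P.map ⇑T ≠ P) :
    volume {x : EuclideanSpace ℝ (Fin d) |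
        ∀ t : ℝ, charFn P (t • x) = charFn (P.map ⇑T) (t • x)} = 0 ∧
    ∀ᵐ h ∂(volume : Measure (EuclideanSpace ℝ (Fin d))),
      ∃ t : ℝ, charFn P (t • h) ≠ charFn (P.map ⇑T) (t • h) := by
  have h : volume {x : EuclideanSpace ℝ (Fin d) |
        ∀ t : ℝ, charFn P (t • x) = charFn (P.map ⇑T) (t • x)} = 0 :=
    main_null P hmom hcarleman (LinearMap.toContinuousLinearMap T.toLinearMap) hne
  refine ⟨h, ?_⟩
  rw [ae_iff]
  simpa using h
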